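/- arXiv:1712.01580 — 2 statements merged into one kernel-verified Lean document; each statement's English description precedes it below -/
import Mathlib

section
/- Let f : ℝ × ℝ^k × ℝ → ℝ be smooth with f(0, 0, λ) = 0 for all λ, f₀ := ∂f/∂x(0,0,0) = 0, f₀₀ := ∂²f/∂x²(0,0,0) ≠ 0, and coupling derivatives f_i := ∂f/∂x_i(0,0,0). Let y : [0, λ₀[ → ℝ^k be a continuous germ with y(0) = 0, and suppose each y_i has square-root-order p_i and slope s_i, with p := max_i p_i ≥ 0. Set A = {i : p_i = p} and Z = Σ_{i ∈ A} f_i s_i / f₀₀. If Z > 0, then the only solution of f(x, y(λ), λ) = 0 with (x, λ) in a sufficiently small neighborhood of the origin and λ ≥ 0 is (x, λ) = (0, 0). -/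
/-- The slope of a germ at `0⁺`: `b(μ)/μ → s` as `μ ↘ 0`. -/
def slopeTendsto (b : ℝ → ℝ) (s : ℝ) : Prop :=
  Filter.Tendsto (fun μ => b μ / μ) (nhdsWithin 0 (Set.Ioi 0)) (nhds s)

/-- `g` admits a smooth representative `b*` with `g(λ) = b*(λ^{2^{-p}})` on
`[0, λ₀[` whose slope at `0⁺` is `s`. -/
def sqrtOrderAux (lam0 : ℝ) (g : ℝ → ℝ) (p : ℕ) (s : ℝ) : Prop :=
  ∃ bs : ℝ → ℝ,
    ContDiffOn ℝ (⊤ : ℕ∞) bs (Set.Ico 0 (lam0 ^ (((2 : ℝ) ^ (-(p : ℤ))) : ℝ))) ∧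
    (∀ lam ∈ Set.Ico (0 : ℝ) lam0,
      g lam = bs (lam ^ (((2 : ℝ) ^ (-(p : ℤ))) : ℝ))) ∧
    slopeTendsto bs s

/-- `g : [0, λ₀[ → ℝ` has square-root-order `p` and slope `s`:
either `p = -1`, `s = 0` and `g ≡ 0`, or `p ≥ 0` is the smallest non-negative
integer admitting a smooth representative with nonzero slope `s`. -/
def hasSqrtOrder (lam0 : ℝ) (g : ℝ → ℝ) (p : ℤ) (s : ℝ) : Prop :=
  (p = -1 ∧ s = 0 ∧ ∀ lam ∈ Set.Ico (0 : ℝ) lam0, g lam = 0) ∨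
  (0 ≤ p ∧ s ≠ 0 ∧ sqrtOrderAux lam0 g p.toNat s ∧
    ∀ q : ℕ, (q : ℤ) < p → ∀ s' : ℝ, s' ≠ 0 → ¬ sqrtOrderAux lam0 g q s')

lemma aux_tendsto (lam0 : ℝ) (hlam0 : 0 < lam0) (g : ℝ → ℝ) (p : ℤ) (s : ℝ)
    (h : hasSqrtOrder lam0 g p s) (P : ℕ) (hP : p ≤ (P : ℤ)) :
    Filter.Tendsto (fun lam => g lam / lam ^ (((2 : ℝ) ^ (-(P : ℤ))) : ℝ))
      (nhdsWithin 0 (Set.Ioi 0)) (nhds (if p = (P : ℤ) then s else 0)) := by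
  have hmem : ∀ᶠ lam : ℝ in nhdsWithin 0 (Set.Ioi 0), lam ∈ Set.Ioo 0 lam0 :=
    Ioo_mem_nhdsGT hlam0
  have hpow : ∀ e : ℝ, 0 < e → Filter.Tendsto (fun lam : ℝ => lam ^ e)
      (nhdsWithin 0 (Set.Ioi 0)) (nhds 0) := by
    intro e he
    have := (Real.continuousAt_rpow_const 0 e (Or.inr he.le)).tendsto
    rw [Real.zero_rpow he.ne'] at this
    exact this.mono_left nhdsWithin_le_nhds
  rcases h with ⟨hp, hs, hg⟩ | ⟨hp, hs, ⟨bs, -, hbs, hsl⟩, -⟩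
  · rw [if_neg (by omega)]
    refine tendsto_const_nhds.congr' ?_
    filter_upwards [hmem] with lam hl
    rw [hg lam ⟨hl.1.le, hl.2⟩]; simp
  · obtain ⟨q, rfl⟩ := Int.eq_ofNat_of_zero_le hp
    simp only [Int.toNat_natCast] at hbs
    have hqP : q ≤ P := by exact_mod_cast hP
    have hq0 : (0:ℝ) < (2 : ℝ) ^ (-(q : ℤ)) := by positivity
    have h1 : Filter.Tendsto (fun lam : ℝ => lam ^ (((2 : ℝ) ^ (-(q : ℤ))) : ℝ))
        (nhdsWithin 0 (Set.Ioi 0)) (nhdsWithin 0 (Set.Ioi 0)) := by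
      refine tendsto_nhdsWithin_iff.2 ⟨hpow _ hq0, ?_⟩
      filter_upwards [hmem] with lam hl
      exact Real.rpow_pos_of_pos hl.1 _
    have h2 := hsl.comp h1
    have h3 : Filter.Tendsto (fun lam : ℝ =>
        lam ^ ((2 : ℝ) ^ (-(q : ℤ)) - (2 : ℝ) ^ (-(P : ℤ)) : ℝ))
        (nhdsWithin 0 (Set.Ioi 0)) (nhds (if (q : ℤ) = (P : ℤ) then 1 else 0)) := by
      split_ifs with hc
      · rw [hc]; simp
      · apply hpow
        rw [sub_pos]
        apply zpow_lt_zpow_right₀ (by norm_num)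
        omega
    have h4 := h2.mul h3
    have : s * (if (q : ℤ) = (P : ℤ) then (1:ℝ) else 0) = if (q : ℤ) = (P : ℤ) then s else 0 := by
      split_ifs <;> simp
    rw [this] at h4
    refine h4.congr' ?_
    filter_upwards [hmem] with lam hl
    simp only [Function.comp]
    rw [hbs lam ⟨hl.1.le, hl.2⟩, Real.rpow_sub hl.1]
    have := (Real.rpow_pos_of_pos hl.1 ((2 : ℝ) ^ (-(q : ℤ)))).ne'
    field_simp

lemma aux_min (g : ℝ → ℝ) (hg : ContDiff ℝ 2 g) (h0 : g 0 = 0) (h1 : deriv g 0 = 0)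
    (h2 : deriv (deriv g) 0 = 1) : ∀ᶠ x in nhds (0:ℝ), x ^ 2 / 4 ≤ g x := by
  have hd : Differentiable ℝ g := hg.differentiable (by norm_num)
  have hd' : Differentiable ℝ (deriv g) := by
    have : ContDiff ℝ (1 + 1) g := by simpa [one_add_one_eq_two] using hg
    exact (contDiff_succ_iff_deriv.1 this).2.2.differentiable (by norm_num)
  have e1 : deriv (fun x => g x - x ^ 2 / 4) = fun x => deriv g x - x / 2 := by
    ext x
    have h := ((hd x).hasDerivAt.sub (((hasDerivAt_id x).pow 2).div_const 4)).deriv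
    refine Eq.trans ?_ (h.trans ?_)
    · rfl
    · simp; ring
  have e2 : deriv (fun x => deriv g x - x / 2) 0 = 1 / 2 := by
    have h := ((hd' 0).hasDerivAt.sub ((hasDerivAt_id (0:ℝ)).div_const 2)).deriv
    rw [h2] at h
    refine Eq.trans ?_ (h.trans ?_)
    · rfl
    · norm_num
  have := isLocalMin_of_deriv_deriv_pos (f := fun x => g x - x ^ 2 / 4) (x₀ := 0)
    (by rw [e1, e2]; norm_num) (by rw [e1]; simp [h1])
    (hd.continuous.sub (by fun_prop)).continuousAt
  filter_upwards [this] with x hx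
  simp [h0] at hx
  exact hx

/-- growth lemma, part (ii): if `Z = (Σ_{i∈A} f_i s_i)/f₀₀ > 0`,
then near the origin the only solution of `f(x, y(λ), λ) = 0` with `λ ≥ 0` is
`(x, λ) = (0, 0)`. -/
theorem stmt_17 {k : ℕ} (f : ℝ → (Fin k → ℝ) → ℝ → ℝ)
    (hsm : ContDiff ℝ (⊤ : ℕ∞) (fun p : ℝ × (Fin k → ℝ) × ℝ => f p.1 p.2.1 p.2.2))
    (htriv : ∀ lam : ℝ, f 0 0 lam = 0)
    (hf0 : deriv (fun x => f x 0 0) 0 = 0)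
    (f00 : ℝ) (hf00 : f00 = deriv (deriv (fun x => f x 0 0)) 0) (hf00ne : f00 ≠ 0)
    (fc : Fin k → ℝ)
    (hfc : ∀ i, fc i = deriv (fun t => f 0 (fun j => if j = i then t else 0) 0) 0)
    (lam0 : ℝ) (hlam0 : 0 < lam0)
    (y : ℝ → Fin k → ℝ) (hy : ContinuousOn y (Set.Ico 0 lam0)) (hy0 : y 0 = 0)
    (p : Fin k → ℤ) (s : Fin k → ℝ)
    (hsro : ∀ i, hasSqrtOrder lam0 (fun lam => y lam i) (p i) (s i))
    (pmax : ℤ) (hpmax : 0 ≤ pmax) (hub : ∀ i, p i ≤ pmax) (hex : ∃ i, p i = pmax)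
    (hZ : (∑ i ∈ Finset.univ.filter (fun i => p i = pmax), fc i * s i) / f00 > 0) :
    ∃ ε > (0 : ℝ), ∀ x lam : ℝ, 0 ≤ lam → lam < ε → |x| < ε →
      f x (y lam) lam = 0 → x = 0 ∧ lam = 0 := by
  obtain ⟨P, rfl⟩ := Int.eq_ofNat_of_zero_le hpmax
  set F : ℝ × (Fin k → ℝ) × ℝ → ℝ := fun p => f p.1 p.2.1 p.2.2 with hF
  set S : ℝ := ∑ i ∈ Finset.univ.filter (fun i => p i = (P : ℤ)), fc i * s i with hS
  set t : Fin k → ℝ := fun i => if p i = (P : ℤ) then s i else 0 with ht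
  have hSt : S = ∑ i, fc i * t i := by
    rw [hS, Finset.sum_filter]
    refine Finset.sum_congr rfl fun i _ => ?_
    simp only [ht]; split_ifs <;> simp
  -- minimum part
  have hg : ContDiff ℝ 2 (fun x => f x 0 0) := by
    have h : ContDiff ℝ (⊤ : ℕ∞) (fun x : ℝ => F (x, 0, 0)) := hsm.comp (by fun_prop)
    exact h.of_le (WithTop.coe_le_coe.2 (le_top : (2 : ℕ∞) ≤ ⊤))
  have hmin := aux_min (fun x => f x 0 0 / f00) (hg.div_const _)
    (by simp [htriv]) (by rw [deriv_div_const, hf0]; simp) (by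
      have : deriv (fun x => f x 0 0 / f00) = fun x => deriv (fun x => f x 0 0) x / f00 := by
        ext x; rw [deriv_div_const]
      rw [this, deriv_div_const, ← hf00, div_self hf00ne])
  -- derivative part
  have hstrict : HasStrictFDerivAt F (fderiv ℝ F 0) 0 :=
    hsm.contDiffAt.hasStrictFDerivAt (by simp)
  have hFd : HasFDerivAt F (fderiv ℝ F 0) 0 := hstrict.hasFDerivAt
  have hDl : fderiv ℝ F 0 (0, 0, 1) = 0 := by
    have h1 : HasDerivAt (fun l : ℝ => ((0 : ℝ), (0 : Fin k → ℝ), l)) (0, 0, 1) 0 :=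
      (hasDerivAt_const _ _).prodMk ((hasDerivAt_const _ _).prodMk (hasDerivAt_id _))
    have h2 := HasFDerivAt.comp_hasDerivAt (0:ℝ) (f := fun l : ℝ => ((0 : ℝ), (0 : Fin k → ℝ), l)) hFd h1
    have h3 : (F ∘ fun l : ℝ => ((0 : ℝ), (0 : Fin k → ℝ), l)) = fun _ => 0 := by
      ext l; simp [hF, htriv]
    rw [h3] at h2
    exact h2.unique (hasDerivAt_const _ _)
  have hDi : ∀ i, fderiv ℝ F 0 (0, Pi.single i 1, 0) = fc i := by
    intro i
    have h0 : HasDerivAt (fun l : ℝ => (Pi.single i l : Fin k → ℝ)) (Pi.single i 1) 0 := by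
      rw [hasDerivAt_pi]
      intro j
      by_cases hj : j = i
      · subst hj; simpa only [Pi.single_eq_same] using hasDerivAt_id' (0:ℝ)
      · simpa [Pi.single_apply, hj] using hasDerivAt_const (0:ℝ) (0:ℝ)
    have h1 : HasDerivAt (fun l : ℝ => ((0 : ℝ), (Pi.single i l : Fin k → ℝ), (0:ℝ)))
        (0, Pi.single i 1, 0) 0 :=
      (hasDerivAt_const _ _).prodMk (h0.prodMk (hasDerivAt_const _ _))
    have hz : ((0 : ℝ), (Pi.single i 0 : Fin k → ℝ), (0:ℝ)) = 0 := by simp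
    have h2 := HasFDerivAt.comp_hasDerivAt (0:ℝ)
      (f := fun l : ℝ => ((0 : ℝ), (Pi.single i l : Fin k → ℝ), (0:ℝ))) (by rw [hz]; exact hFd) h1
    rw [hfc i, ← h2.deriv]
    congr 1
    ext l
    simp only [hF, Function.comp]
    congr 1
    ext j
    simp [Pi.single_apply]
  have hD : ∀ (v : Fin k → ℝ) (l : ℝ), fderiv ℝ F 0 (0, v, l) = ∑ i, fc i * v i := by
    intro v l
    have : ((0:ℝ), v, l) = (∑ i, v i • ((0:ℝ), (Pi.single i 1 : Fin k → ℝ), (0:ℝ)))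
        + l • ((0:ℝ), (0 : Fin k → ℝ), (1:ℝ)) := by
      refine Prod.ext ?_ (Prod.ext ?_ ?_)
      · simp [Prod.fst_sum]
      · ext j
        simp [Prod.snd_sum, Prod.fst_sum, Finset.sum_apply, Pi.single_apply]
      · simp [Prod.snd_sum]
    rw [this, map_add, map_sum, map_smul, hDl]
    simp only [map_smul, hDi, smul_eq_mul, mul_zero, add_zero]
    exact Finset.sum_congr rfl fun i _ => mul_comm _ _
  -- asymptotics of y
  set e : ℝ := (2 : ℝ) ^ (-(P : ℤ)) with he
  have he1 : e ≤ 1 := by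
    rw [he]; exact zpow_le_one_of_nonpos₀ (by norm_num) (by omega)
  have hyi : ∀ i, Filter.Tendsto (fun lam => y lam i / lam ^ e)
      (nhdsWithin 0 (Set.Ioi 0)) (nhds (t i)) := fun i =>
    aux_tendsto lam0 hlam0 _ (p i) (s i) (hsro i) P (hub i)
  have hsum : Filter.Tendsto (fun lam => (∑ i, fc i * (y lam i / lam ^ e)) / f00)
      (nhdsWithin 0 (Set.Ioi 0)) (nhds (S / f00)) := by
    rw [hSt]
    exact (tendsto_finsetSum _ fun i _ => (hyi i).const_mul _).div_const _
  have hnorm : Filter.Tendsto (fun lam => ‖fun i => y lam i / lam ^ e‖)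
      (nhdsWithin 0 (Set.Ioi 0)) (nhds ‖t‖) :=
    (tendsto_pi_nhds.2 hyi).norm
  set Z := S / f00 with hZdef
  have hZ' : 0 < Z := hZ
  set M : ℝ := ‖t‖ + 1 with hM
  have hMpos : 0 < M := by positivity
  have hf00' : 0 < |f00| := abs_pos.2 hf00ne
  set c : ℝ := Z / 4 * |f00| / M with hc
  have hcpos : 0 < c := by positivity
  have hlo := hstrict.isLittleO.bound hcpos
  rw [nhds_prod_eq] at hlo
  have hycont : Filter.Tendsto y (nhdsWithin 0 (Set.Ioi 0)) (nhds 0) := by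
    have := (hy 0 ⟨le_rfl, hlam0⟩).tendsto
    rw [hy0] at this
    rw [← nhdsWithin_Ioo_eq_nhdsGT hlam0]
    exact this.mono_left (nhdsWithin_mono _ Set.Ioo_subset_Ico_self)
  have hid : Filter.Tendsto (fun l : ℝ => l) (nhdsWithin 0 (Set.Ioi 0)) (nhds 0) :=
    Filter.tendsto_id.mono_left nhdsWithin_le_nhds
  have hT : Filter.Tendsto (fun q : ℝ × ℝ => ((q.1, y q.2, q.2), (q.1, (0 : Fin k → ℝ), (0:ℝ))))
      (nhds 0 ×ˢ nhdsWithin 0 (Set.Ioi 0))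
      (nhds (0 : ℝ × (Fin k → ℝ) × ℝ) ×ˢ nhds (0 : ℝ × (Fin k → ℝ) × ℝ)) := by
    refine Filter.Tendsto.prodMk ?_ ?_
    · exact Filter.tendsto_fst.prodMk_nhds
        ((hycont.comp Filter.tendsto_snd).prodMk_nhds (hid.comp Filter.tendsto_snd))
    · exact Filter.tendsto_fst.prodMk_nhds (tendsto_const_nhds.prodMk_nhds tendsto_const_nhds)
  have hev := hT.eventually hlo
  have hlam : ∀ᶠ lam : ℝ in nhdsWithin 0 (Set.Ioi 0), lam ∈ Set.Ioo 0 1 ∧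
      Z / 2 < (∑ i, fc i * (y lam i / lam ^ e)) / f00 ∧ ‖fun i => y lam i / lam ^ e‖ < M :=
    (Filter.Eventually.and (Ioo_mem_nhdsGT one_pos)
      ((hsum.eventually (lt_mem_nhds (half_lt_self hZ'))).and
        (hnorm.eventually (gt_mem_nhds (by simp [hM])))))
  have hall : ∀ᶠ q : ℝ × ℝ in nhds 0 ×ˢ nhdsWithin 0 (Set.Ioi 0), f q.1 (y q.2) q.2 ≠ 0 := by
    filter_upwards [hev, hlam.prod_inr _, hmin.prod_inl _] with q h1 h2 h3 hzero
    obtain ⟨x, l⟩ := q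
    obtain ⟨⟨hl0, hl1⟩, h2a, h2b⟩ := h2
    simp only [Prod.mk_sub_mk, sub_self, sub_zero, hD] at h1 h3 hzero
    have hmu : 0 < l ^ e := Real.rpow_pos_of_pos hl0 _
    have hle : l ≤ l ^ e := by
      simpa using Real.rpow_le_rpow_of_exponent_ge hl0 hl1.le he1
    have hyn : ‖y l‖ ≤ M * l ^ e := by
      rw [pi_norm_le_iff_of_nonneg (by positivity)]
      intro i
      have := (norm_le_pi_norm (fun i => y l i / l ^ e) i).trans h2b.le
      rw [norm_div, Real.norm_of_nonneg hmu.le, div_le_iff₀ hmu] at this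
      exact this
    have hnn : ‖((0:ℝ), y l, l)‖ ≤ M * l ^ e := by
      rw [Prod.norm_def, Prod.norm_def]
      refine max_le (by simp; positivity) (max_le hyn ?_)
      simp only [Real.norm_of_nonneg hl0.le]
      refine hle.trans (le_mul_of_one_le_left hmu.le ?_)
      simp [hM]
    have hs' : ∑ i, fc i * (y l i / l ^ e) = (∑ i, fc i * y l i) / l ^ e := by
      rw [Finset.sum_div]; exact Finset.sum_congr rfl fun i _ => by ring
    rw [hs'] at h2a
    have h1' : |f x (y l) l - f x 0 0 - ∑ i, fc i * y l i| ≤ Z / 4 * l ^ e * |f00| := by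
      refine (h1.trans (mul_le_mul_of_nonneg_left hnn hcpos.le)).trans_eq ?_
      rw [hc]; field_simp
    rw [hzero, ← div_le_iff₀ hf00', ← abs_div] at h1'
    have h5 := (abs_le.1 h1').1
    have h6 : Z / 2 * l ^ e < (∑ i, fc i * y l i) / f00 := by
      rw [div_right_comm (∑ i, fc i * y l i), lt_div_iff₀ hmu] at h2a
      exact h2a
    have h7 : (0 - f x 0 0 - ∑ i, fc i * y l i) / f00
        = - (f x 0 0 / f00) - (∑ i, fc i * y l i) / f00 := by ring
    have h8 := (abs_le.1 h1').1
    rw [h7] at h8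
    have h9 : 0 < Z * l ^ e := by positivity
    nlinarith [sq_nonneg x]
  rw [Filter.eventually_prod_iff] at hall
  obtain ⟨pa, hpa, pb, hpb, hab⟩ := hall
  obtain ⟨ε1, hε1, H1⟩ := Metric.eventually_nhds_iff.1 (hpa.and hmin)
  obtain ⟨ε2, hε2, H2⟩ := mem_nhdsGT_iff_exists_Ioo_subset.1 hpb
  refine ⟨min ε1 ε2, lt_min hε1 hε2, fun x lam hl0 hl hx hz => ?_⟩
  have hx1 := H1 (y := x) (by simpa using hx.trans_le (min_le_left _ _))
  rcases hl0.eq_or_lt with h | h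
  · subst h
    rw [hy0] at hz
    have := hx1.2
    rw [hz] at this
    refine ⟨?_, rfl⟩
    have : x ^ 2 = 0 := le_antisymm (by simp at this; linarith) (sq_nonneg x)
    exact pow_eq_zero_iff (by norm_num) |>.1 this
  · exact absurd hz (hab hx1.1 (H2 ⟨h, hl.trans_le (min_le_right _ _)⟩))
end

section
/- Let f : ℝ × ℝ^k × ℝ → ℝ be smooth with f(0, 0, λ) = 0 for all λ, f₀ := ∂f/∂x(0,0,0) = 0, f₀₀ := ∂²f/∂x²(0,0,0) ≠ 0. Let y : [0, λ₀[ → ℝ^k be a germ whose components y_i have square-root-orders p_i and slopes s_i with p := max_i p_i ≥ 0, let A = {i : p_i = p} and Z = Σ_{i ∈ A} f_i s_i / f₀₀, and assume Z < 0. Then there exist 0 < λ₀* ≤ λ₀ and germs b⁺, b⁻ : [0, λ₀*[ → ℝ of square-root-order p + 1 with slopes +√(−2Z) and −√(−2Z) respectively, such that for 0 < λ < λ₀*, f(x, y(λ), λ) = 0 (with x in a suitable neighborhood of 0) if and only if x = b⁺(λ) or x = b⁻(λ). -/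
section AuxSection
open Set Filter Topology
open scoped ContDiff

theorem aux_param {H : Type} [NormedAddCommGroup H] [NormedSpace ℝ H] [FiniteDimensional ℝ H] (n : ℕ) :
    ∀ (F : Type) [NormedAddCommGroup F] [NormedSpace ℝ F] [CompleteSpace F] (f : H → ℝ → F),
      ContDiff ℝ n (fun q : H × ℝ => f q.1 q.2) →
      ContDiff ℝ n (fun x => ∫ t in (0:ℝ)..1, f x t) := by
  induction n with
  | zero =>
    intro F _ _ _ f hf
    rw [Nat.cast_zero, contDiff_zero] at hf ⊢
    exact intervalIntegral.continuous_parametric_intervalIntegral_of_continuous' hf 0 1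
  | succ n ih =>
    intro F _ _ _ f hf
    have hf1 : Differentiable ℝ (fun q : H × ℝ => f q.1 q.2) :=
      hf.differentiable (by simp)
    set F' : H → ℝ → (H →L[ℝ] F) := fun x t =>
      (fderiv ℝ (fun q : H × ℝ => f q.1 q.2) (x, t)).comp (ContinuousLinearMap.inl ℝ H ℝ) with hF'
    have hF's : ContDiff ℝ n (fun q : H × ℝ => F' q.1 q.2) := by
      have h1 : ContDiff ℝ n (fderiv ℝ (fun q : H × ℝ => f q.1 q.2)) :=
        hf.fderiv_right (by push_cast; exact le_rfl)
      exact h1.clm_comp contDiff_const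
    have hd : ∀ x t, HasFDerivAt (fun x => f x t) (F' x t) x := by
      intro x t
      have h1 := (hf1 (x, t)).hasFDerivAt
      have h2 : HasFDerivAt (fun x : H => (x, t)) (ContinuousLinearMap.inl ℝ H ℝ) x :=
        hasFDerivAt_prodMk_left x t
      exact h1.comp x h2
    have hint := ih (H →L[ℝ] F) F' hF's
    push_cast
    rw [contDiff_succ_iff_hasFDerivAt]
    refine ⟨_, hint, fun x => ?_⟩
    have hcont : Continuous (fun q : H × ℝ => F' q.1 q.2) := hF's.continuous
    have hfc := hf.continuous
    obtain ⟨C, hC⟩ := ((isCompact_closedBall x 1).prod (isCompact_Icc (a := (0:ℝ)) (b := 1))).exists_bound_of_continuousOn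
      hcont.continuousOn
    refine intervalIntegral.hasFDerivAt_integral_of_dominated_of_fderiv_le
      (F := f) (F' := F') (bound := fun _ => C) (Metric.closedBall_mem_nhds x one_pos) ?_ ?_ ?_ ?_ ?_ ?_
    · refine Eventually.of_forall fun z => ?_
      exact (hfc.comp (Continuous.prodMk_right z)).aestronglyMeasurable
    · exact (hfc.comp (Continuous.prodMk_right x)).intervalIntegrable _ _
    · exact (hcont.comp (Continuous.prodMk_right x)).aestronglyMeasurable
    · refine Eventually.of_forall fun t ht z hz => ?_
      rw [uIoc_of_le zero_le_one] at ht
      exact hC (z, t) ⟨hz, ht.1.le, ht.2⟩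
    · simp
    · exact Eventually.of_forall fun t ht z hz => hd z t

theorem aux_hadamard {E : Type} [NormedAddCommGroup E] [NormedSpace ℝ E] [FiniteDimensional ℝ E]
    (Φ : ℝ × E → ℝ) (hΦ : ContDiff ℝ ∞ Φ) (h0 : ∀ w, Φ (0, w) = 0) :
    ∃ Ψ : ℝ × E → ℝ, ContDiff ℝ ∞ Ψ ∧ ∀ m w, Φ (m, w) = m * Ψ (m, w) := by
  have hfd : ContDiff ℝ ∞ (fderiv ℝ Φ) := hΦ.fderiv_right (by simp)
  refine ⟨fun q : ℝ × E => ∫ t in (0:ℝ)..1, fderiv ℝ Φ (t * q.1, q.2) (1, 0), ?_, ?_⟩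
  · rw [contDiff_infty]
    intro n
    refine aux_param n ℝ (fun (q : ℝ × E) t => fderiv ℝ Φ (t * q.1, q.2) (1, 0)) ?_
    refine ContDiff.of_le ?_ (show (n : WithTop ℕ∞) ≤ ∞ by exact_mod_cast le_top)
    refine ContDiff.clm_apply (hfd.comp ?_) contDiff_const
    fun_prop
  · intro m w
    have hd : ∀ t : ℝ, HasDerivAt (fun t : ℝ => Φ (t * m, w)) (m * fderiv ℝ Φ (t * m, w) (1, 0)) t := by
      intro t
      have h1 := (hΦ.differentiable (by simp) (t * m, w)).hasFDerivAt
      have h2 : HasDerivAt (fun t : ℝ => (t * m, w)) (m, (0:E)) t := by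
        simpa using (((hasDerivAt_id t).mul_const m).prodMk (hasDerivAt_const t w))
      have h3 := h1.comp_hasDerivAt t h2
      refine h3.congr_deriv ?_
      have : ((m, (0:E)) : ℝ × E) = m • ((1:ℝ), (0:E)) := by simp
      rw [this, map_smul, smul_eq_mul]
    have hc : Continuous fun t : ℝ => fderiv ℝ Φ (t * m, w) (1, 0) := by
      have := hfd.continuous
      fun_prop
    have := intervalIntegral.integral_eq_sub_of_hasDerivAt (a := 0) (b := 1) (fun t _ => hd t)
      ((continuous_const.mul hc).intervalIntegrable _ _)
    rw [intervalIntegral.integral_const_mul] at this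
    simp only [one_mul, zero_mul, h0, sub_zero] at this
    exact this.symm

theorem aux_implicit {E : Type} [NormedAddCommGroup E] [NormedSpace ℝ E] [FiniteDimensional ℝ E]
    (G : E × ℝ → ℝ) (hG : ContDiff ℝ ∞ G) (u : E) (z : ℝ) (hz : G (u, z) = 0)
    (hd : fderiv ℝ G (u, z) (0, 1) ≠ 0) :
    ∃ ψ : E → ℝ, ψ u = z ∧ ∀ᶠ w in 𝓝 u, G (w, ψ w) = 0 ∧ ContDiffAt ℝ ∞ ψ w := by
  have hinv : ∀ v : E × ℝ, fderiv ℝ G v (0, 1) ≠ 0 →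
      (fderiv ℝ G v ∘L ContinuousLinearMap.inr ℝ E ℝ).IsInvertible := by
    intro v hv
    refine ⟨ContinuousLinearEquiv.unitsEquivAut ℝ (Units.mk0 _ hv), ?_⟩
    ext
    simp
  have hn : (∞ : WithTop ℕ∞) ≠ 0 := by simp
  have cd : ∀ v, ContDiffAt ℝ ∞ G v := fun v => hG.contDiffAt
  set ψ := (cd (u, z)).implicitFunction hn (hinv _ hd) with hψ
  have h1 : ψ u = z := (cd (u, z)).implicitFunction_apply_self hn (hinv _ hd)
  have h2 : ContDiffAt ℝ ∞ ψ u := (cd (u, z)).contDiffAt_implicitFunction hn (hinv _ hd)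
  have h3 : ∀ᶠ w in 𝓝 u, G (w, ψ w) = 0 := by
    have := (cd (u, z)).eventually_apply_implicitFunction hn (hinv _ hd)
    rw [hz] at this
    exact this
  have h4 : ∀ᶠ w in 𝓝 u, ContDiffAt ℝ 1 ψ w :=
    (h2.of_le (by simp)).eventually (by simp)
  have h5 : ∀ᶠ w in 𝓝 u, fderiv ℝ G (w, ψ w) (0, 1) ≠ 0 := by
    have hc : Continuous fun v => fderiv ℝ G v (0, 1) := by
      have := (hG.fderiv_right (m := ∞) (by simp)).continuous
      fun_prop
    have hc2 : ContinuousAt (fun w => fderiv ℝ G (w, ψ w) (0, 1)) u := by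
      refine ContinuousAt.comp (g := fun v => fderiv ℝ G v (0, 1)) hc.continuousAt ?_
      exact continuousAt_id.prodMk h2.continuousAt
    refine hc2.eventually_ne ?_
    rw [h1]; exact hd
  refine ⟨ψ, h1, ?_⟩
  filter_upwards [h3.eventually_nhds, h4, h5] with w hw hw4 hw5
  refine ⟨hw.self_of_nhds, ?_⟩
  have k1 := (cd (w, ψ w)).contDiffAt_implicitFunction hn (hinv _ hw5)
  have k2 := (cd (w, ψ w)).eventually_apply_eq_iff_implicitFunction hn (hinv _ hw5)
  refine k1.congr_of_eventuallyEq ?_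
  have hc : Tendsto (fun w' => (w', ψ w')) (𝓝 w) (𝓝 (w, ψ w)) :=
    continuousAt_id.prodMk hw4.continuousAt
  filter_upwards [hc.eventually k2, hw] with w' a b
  refine (a.1 ?_).symm
  rw [b, hw.self_of_nhds]

theorem aux_dvd (r : ℝ) (hr : 0 < r) (m : ℕ) : ∀ (n : ℕ) (b g : ℝ → ℝ),
    ContDiffOn ℝ ∞ g (Ico 0 r) → b 0 = 0 → ContinuousOn b (Ico 0 r) →
    (∀ t ∈ Ioo 0 r, HasDerivAt b (t ^ n * g t) t) →
    ContDiffOn ℝ m (fun t => if t = 0 then g 0 / (n + 1) else b t / t ^ (n + 1)) (Ico 0 r) := by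
  have main : ∀ (n : ℕ) (b g : ℝ → ℝ),
      ContDiffOn ℝ ∞ g (Ico 0 r) → b 0 = 0 → ContinuousOn b (Ico 0 r) →
      (∀ t ∈ Ioo 0 r, HasDerivAt b (t ^ n * g t) t) →
      ContinuousOn (fun t => if t = 0 then g 0 / (n + 1) else b t / t ^ (n + 1)) (Ico 0 r) := by
    intro n b g hg hb0 hbc hb t ht
    have h0mem : (0:ℝ) ∈ Ico 0 r := ⟨le_rfl, hr⟩
    rcases eq_or_lt_of_le ht.1 with h | h
    · subst h
      have hlim : Tendsto (fun t => b t / t ^ (n + 1)) (𝓝[>] 0) (𝓝 (g 0 / (n + 1))) := by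
        have hev : ∀ᶠ t in 𝓝[>] (0:ℝ), t ∈ Ioo 0 r := Ioo_mem_nhdsGT hr
        have hle : 𝓝[>] (0:ℝ) ≤ 𝓝[Ico 0 r] 0 :=
          le_inf nhdsWithin_le_nhds (le_principal_iff.2 (mem_of_superset hev Ioo_subset_Ico_self))
        refine HasDerivAt.lhopital_zero_nhdsGT (f' := fun t => t ^ n * g t)
          (g' := fun t => (n + 1) * t ^ n) ?_ ?_ ?_ ?_ ?_ ?_
        · filter_upwards [hev] with t ht using hb t ht
        · filter_upwards with t
          simpa using hasDerivAt_pow (n + 1) t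
        · filter_upwards [hev] with t ht
          have := ht.1
          positivity
        · have := (hbc 0 h0mem).mono_left hle
          rwa [hb0] at this
        · have : Tendsto (fun t : ℝ => t ^ (n + 1)) (𝓝 0) (𝓝 (0 ^ (n + 1))) :=
            (continuous_pow (n + 1)).tendsto 0
          simp only [ne_eq, Nat.add_eq_zero_iff, one_ne_zero, and_false, not_false_eq_true, zero_pow] at this
          exact this.mono_left nhdsWithin_le_nhds
        · have : Tendsto (fun t => g t / (n + 1)) (𝓝[>] 0) (𝓝 (g 0 / (n + 1))) :=
            ((hg.continuousOn 0 h0mem).mono_left hle).div_const _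
          refine this.congr' ?_
          filter_upwards [hev] with t ht
          have := ht.1
          field_simp
      have hI : Ico (0:ℝ) r ⊆ insert 0 (Ioi 0) := by
        intro x hx
        rcases eq_or_lt_of_le hx.1 with h | h
        · exact Or.inl h.symm
        · exact Or.inr h
      refine ContinuousWithinAt.mono ?_ hI
      rw [continuousWithinAt_insert_self]
      unfold ContinuousWithinAt
      simp only [if_true]
      refine hlim.congr' ?_
      filter_upwards [self_mem_nhdsWithin] with x hx
      rw [if_neg (ne_of_gt hx)]
    · have h1 : ContinuousWithinAt (fun t => b t / t ^ (n + 1)) (Ico 0 r) t :=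
        (hbc t ht).div (by fun_prop) (by positivity)
      refine h1.congr_of_eventuallyEq ?_ ?_
      · filter_upwards [nhdsWithin_le_nhds (lt_mem_nhds h)] with x hx
        rw [if_neg (ne_of_gt hx)]
      · rw [if_neg (ne_of_gt h)]
  have hI : Ico (0:ℝ) r ∈ 𝓝[>] (0:ℝ) := Ico_mem_nhdsGT hr
  have hud : UniqueDiffOn ℝ (Ico (0:ℝ) r) := uniqueDiffOn_Ico 0 r
  induction m with
  | zero =>
    intro n b g h1 h2 h3 h4
    rw [Nat.cast_zero, contDiffOn_zero]
    exact main n b g h1 h2 h3 h4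
  | succ m ih =>
    intro n b g hg hb0 hbc hb
    have h0mem : (0:ℝ) ∈ Ico 0 r := ⟨le_rfl, hr⟩
    have hg' : ContDiffOn ℝ ∞ (derivWithin g (Ico 0 r)) (Ico 0 r) :=
      hg.derivWithin hud (by simp)
    have hgd : ∀ t ∈ Ioo 0 r, HasDerivAt g (derivWithin g (Ico 0 r) t) t := by
      intro t ht
      exact ((hg.differentiableOn (by simp)) t (Ioo_subset_Ico_self ht)).hasDerivWithinAt.hasDerivAt
        (Ico_mem_nhds ht.1 ht.2)
    set g' := derivWithin g (Ico 0 r)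
    set d : ℝ → ℝ := fun t => t ^ (n + 1) * g t - (n + 1) * b t with hd
    have hd0 : d 0 = 0 := by simp [hd, hb0]
    have hdc : ContinuousOn d (Ico 0 r) :=
      ((continuousOn_pow _).mul hg.continuousOn).sub (continuousOn_const.mul hbc)
    have hdd : ∀ t ∈ Ioo 0 r, HasDerivAt d (t ^ (n + 1) * g' t) t := by
      intro t ht
      have h := ((hasDerivAt_pow (n + 1) t).mul (hgd t ht)).sub ((hb t ht).const_mul ((n:ℝ) + 1))
      refine h.congr_deriv ?_
      push_cast
      ring
    have key := ih (n + 1) d g' hg' hd0 hdc hdd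
    have keyc := main (n + 1) d g' hg' hd0 hdc hdd
    have mc := main n b g hg hb0 hbc hb
    set c : ℝ → ℝ := fun t => if t = 0 then g 0 / (n + 1) else b t / t ^ (n + 1) with hc
    set c' : ℝ → ℝ := fun t => if t = 0 then g' 0 / ((n + 1 : ℕ) + 1) else d t / t ^ (n + 1 + 1) with hc'
    have hcd : ∀ t ∈ Ioo 0 r, HasDerivAt c (c' t) t := by
      intro t ht
      have htne : t ≠ 0 := ne_of_gt ht.1
      have h := (hb t ht).div (hasDerivAt_pow (n + 1) t) (pow_ne_zero _ htne)
      refine (h.congr_deriv ?_).congr_of_eventuallyEq ?_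
      · simp only [hc', hd, if_neg htne]
        push_cast
        field_simp
        ring
      · filter_upwards [lt_mem_nhds ht.1] with x hx
        simp [hc, ne_of_gt hx]
    have hcd2 : ∀ t ∈ Ico 0 r, HasDerivWithinAt c (c' t) (Ico 0 r) t := by
      intro t ht
      rcases eq_or_lt_of_le ht.1 with h | h
      · subst h
        have hle : 𝓝[>] (0:ℝ) ≤ 𝓝[Ico 0 r] 0 :=
          le_inf nhdsWithin_le_nhds (le_principal_iff.2 hI)
        have := hasDerivWithinAt_Ici_of_tendsto_deriv (s := Ioo 0 r) (f := c) (a := 0) (e := c' 0)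
          (fun t ht => (hcd t ht).differentiableAt.differentiableWithinAt)
          ((mc 0 h0mem).mono Ioo_subset_Ico_self) (Ioo_mem_nhdsGT hr) ?_
        · exact this.mono Ico_subset_Ici_self
        · have := (keyc 0 h0mem).mono_left hle
          refine this.congr' ?_
          filter_upwards [Ioo_mem_nhdsGT hr] with x hx using (hcd x hx).deriv.symm
      · exact (hcd t ⟨h, ht.2⟩).hasDerivWithinAt
    push_cast
    rw [contDiffOn_succ_iff_derivWithin hud]
    refine ⟨fun t ht => (hcd2 t ht).differentiableWithinAt, by simp, ?_⟩
    exact key.congr fun t ht => (hcd2 t ht).derivWithin (hud t ht)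

theorem aux_one_sided (r : ℝ) (hr : 0 < r) (b : ℝ → ℝ) (s : ℝ) (hb : ContDiffOn ℝ ∞ b (Ico 0 r))
    (hs : Tendsto (fun t => b t / t) (𝓝[>] 0) (𝓝 s)) :
    ∃ c : ℝ → ℝ, ContDiffOn ℝ ∞ c (Ico 0 r) ∧ c 0 = s ∧ ∀ t ∈ Ico 0 r, b t = t * c t := by
  have h0mem : (0:ℝ) ∈ Ico 0 r := ⟨le_rfl, hr⟩
  have hle : 𝓝[>] (0:ℝ) ≤ 𝓝[Ico 0 r] 0 :=
    le_inf nhdsWithin_le_nhds (le_principal_iff.2 (Ico_mem_nhdsGT hr))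
  have hb0 : b 0 = 0 := by
    have h1 := (hb.continuousOn 0 h0mem).mono_left hle
    have h2 : Tendsto (fun t : ℝ => b t / t * t) (𝓝[>] 0) (𝓝 (s * 0)) :=
      hs.mul (tendsto_id.mono_left nhdsWithin_le_nhds)
    rw [mul_zero] at h2
    refine tendsto_nhds_unique h1 (h2.congr' ?_)
    filter_upwards [self_mem_nhdsWithin] with t ht
    exact div_mul_cancel₀ _ (ne_of_gt ht)
  have hud : UniqueDiffOn ℝ (Ico (0:ℝ) r) := uniqueDiffOn_Ico 0 r
  have hg : ContDiffOn ℝ ∞ (derivWithin b (Ico 0 r)) (Ico 0 r) := hb.derivWithin hud (by simp)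
  have key := fun m => aux_dvd r hr m 0 b (derivWithin b (Ico 0 r)) hg hb0 hb.continuousOn (by
    intro t ht
    rw [pow_zero, one_mul]
    exact ((hb.differentiableOn (by simp)) t (Ioo_subset_Ico_self ht)).hasDerivWithinAt.hasDerivAt
        (Ico_mem_nhds ht.1 ht.2))
  set c : ℝ → ℝ := fun t => if t = 0 then derivWithin b (Ico 0 r) 0 / ((0:ℕ) + 1) else b t / t ^ (0 + 1) with hc
  have hcs : ContDiffOn ℝ ∞ c (Ico 0 r) := contDiffOn_infty.2 key
  refine ⟨c, hcs, ?_, ?_⟩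
  · refine tendsto_nhds_unique ((hcs.continuousOn 0 h0mem).mono_left hle) (hs.congr' ?_)
    filter_upwards [self_mem_nhdsWithin] with t ht
    have : t ≠ 0 := ne_of_gt (mem_Ioi.1 ht)
    simp [hc, this]
  · intro t ht
    by_cases h : t = 0
    · simp [h, hb0]
    · simp [hc, h]
      field_simp

theorem aux_pow (P q : ℕ) (hq : q ≤ P + 1) (x : ℝ) (hx : 0 ≤ x) :
    (x ^ (2 ^ (P + 1))) ^ ((2:ℝ) ^ (-(q:ℤ))) = x ^ (2 ^ (P + 1 - q)) := by
  rw [← Real.rpow_natCast, ← Real.rpow_mul hx, ← Real.rpow_natCast]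
  congr 1
  push_cast
  rw [zpow_neg, zpow_natCast, ← div_eq_mul_inv, pow_sub₀ _ two_ne_zero hq, div_eq_mul_inv]

theorem aux_pow' (P : ℕ) (l : ℝ) (hl : 0 ≤ l) :
    (l ^ ((2:ℝ) ^ (-((P + 1 : ℕ):ℤ)))) ^ (2 ^ (P + 1)) = l := by
  rw [← Real.rpow_natCast, ← Real.rpow_mul hl]
  push_cast
  rw [zpow_neg, ← Nat.cast_succ, zpow_natCast, inv_mul_cancel₀ (by positivity), Real.rpow_one]

theorem aux_u (lam0 : ℝ) (hlam0 : 0 < lam0) (g : ℝ → ℝ) (p : ℤ) (s : ℝ)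
    (h : hasSqrtOrder lam0 g p s) (P : ℕ) (hp : p ≤ P) :
    ∃ u : ℝ → ℝ, ContDiffOn ℝ ∞ u (Ico 0 (lam0 ^ ((2:ℝ) ^ (-((P + 1 : ℕ):ℤ))))) ∧
      u 0 = (if p = P then s else 0) ∧
      ∀ m ∈ Ico 0 (lam0 ^ ((2:ℝ) ^ (-((P + 1 : ℕ):ℤ)))), g (m ^ (2 ^ (P + 1))) = m ^ 2 * u m := by
  have hM : ∀ m ∈ Ico 0 (lam0 ^ ((2:ℝ) ^ (-((P + 1 : ℕ):ℤ)))), m ^ (2 ^ (P + 1)) ∈ Ico 0 lam0 := by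
    intro m hm
    refine ⟨pow_nonneg hm.1 _, ?_⟩
    calc m ^ (2 ^ (P + 1)) < (lam0 ^ ((2:ℝ) ^ (-((P + 1 : ℕ):ℤ)))) ^ (2 ^ (P + 1)) :=
          pow_lt_pow_left₀ hm.2 hm.1 (by positivity)
      _ = lam0 := aux_pow' P lam0 hlam0.le
  rcases h with ⟨h1, h2, h3⟩ | ⟨h1, h2, ⟨bs, h3, h4, h5⟩, -⟩
  · refine ⟨fun _ => 0, contDiffOn_const, ?_, ?_⟩
    · simp [h2]
    · intro m hm
      rw [h3 _ (hM m hm), mul_zero]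
  · obtain ⟨q, rfl⟩ := Int.eq_ofNat_of_zero_le h1
    have hq : q ≤ P := by exact_mod_cast hp
    simp only [Int.toNat_natCast] at h3 h4
    obtain ⟨c, hc1, hc2, hc3⟩ := aux_one_sided _ (Real.rpow_pos_of_pos hlam0 _) bs s h3 h5
    have hmem : ∀ m ∈ Ico 0 (lam0 ^ ((2:ℝ) ^ (-((P + 1 : ℕ):ℤ)))),
        m ^ (2 ^ (P + 1 - q)) ∈ Ico 0 (lam0 ^ ((2:ℝ) ^ (-(q:ℤ)))) := by
      intro m hm
      refine ⟨pow_nonneg hm.1 _, ?_⟩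
      rw [← aux_pow P q (by omega) m hm.1]
      exact Real.rpow_lt_rpow (hM m hm).1 (hM m hm).2 (by positivity)
    have h2le : 2 ≤ 2 ^ (P + 1 - q) := by
      calc 2 = 2 ^ 1 := rfl
        _ ≤ 2 ^ (P + 1 - q) := Nat.pow_le_pow_right (by norm_num) (by omega)
    refine ⟨fun m => m ^ (2 ^ (P + 1 - q) - 2) * c (m ^ (2 ^ (P + 1 - q))), ?_, ?_, ?_⟩
    · refine ContDiffOn.mul (by fun_prop) (hc1.comp (by fun_prop) hmem)
    · have : (0:ℝ) ^ (2 ^ (P + 1 - q)) = 0 := zero_pow (by positivity)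
      simp only [this, hc2]
      by_cases hqP : q = P
      · subst hqP
        simp
      · have h4le : 2 ^ (P + 1 - q) - 2 ≠ 0 := by
          have : 2 ^ 2 ≤ 2 ^ (P + 1 - q) := Nat.pow_le_pow_right (by norm_num) (by omega)
          omega
        rw [zero_pow h4le, zero_mul, if_neg (by exact_mod_cast hqP)]
    · intro m hm
      rw [h4 _ (hM m hm), aux_pow P q (by omega) m hm.1, hc3 _ (hmem m hm), ← mul_assoc, ← pow_add]
      congr 2
      omega

theorem aux_order (l : ℝ) (hl : 0 < l) (q : ℕ) (bs : ℝ → ℝ) (s : ℝ) (hs : s ≠ 0)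
    (hb : ContDiffOn ℝ ∞ bs (Ico 0 (l ^ ((2:ℝ) ^ (-(q:ℤ))))))
    (hsl : slopeTendsto bs s) :
    hasSqrtOrder l (fun x => bs (x ^ ((2:ℝ) ^ (-(q:ℤ))))) q s := by
  refine Or.inr ⟨by positivity, hs, ⟨bs, by simpa using hb, by simp, hsl⟩, ?_⟩
  rintro q' hq' s' hs' ⟨c, -, hc2, hc3⟩
  have hq'' : q' < q := by exact_mod_cast hq'
  have hlt : (2:ℝ) ^ (-(q:ℤ)) < (2:ℝ) ^ (-(q':ℤ)) :=
    zpow_lt_zpow_right₀ (by norm_num) (by omega)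
  have hα : (0:ℝ) < (2:ℝ) ^ (-(q:ℤ)) := by positivity
  set α := (2:ℝ) ^ (-(q:ℤ))
  set β := (2:ℝ) ^ (-(q':ℤ))
  have T : ∀ γ : ℝ, 0 < γ → Tendsto (fun x : ℝ => x ^ γ) (𝓝[>] 0) (𝓝[>] 0) := by
    intro γ hγ
    refine tendsto_nhdsWithin_iff.2 ⟨?_, ?_⟩
    · have : Tendsto (fun x : ℝ => x ^ γ) (𝓝 0) (𝓝 (0 ^ γ)) :=
        (Real.continuousAt_rpow_const 0 γ (Or.inr hγ.le))
      rw [Real.zero_rpow hγ.ne'] at this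
      exact this.mono_left nhdsWithin_le_nhds
    · filter_upwards [self_mem_nhdsWithin] with x hx
      exact Real.rpow_pos_of_pos hx _
  have t1 := hsl.comp (T α hα)
  have t2 := hc3.comp (T β (hα.trans hlt))
  have t3 := t2.mul ((T (β - α) (sub_pos.2 hlt)).mono_right nhdsWithin_le_nhds)
  rw [mul_zero] at t3
  refine hs (tendsto_nhds_unique t1 (t3.congr' ?_))
  filter_upwards [Ioo_mem_nhdsGT hl] with x hx
  have hx0 : 0 < x := hx.1
  have e := hc2 x ⟨hx.1.le, hx.2⟩
  simp only [Function.comp] at e ⊢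
  rw [e, Real.rpow_sub hx0]
  have := Real.rpow_pos_of_pos hx0 α
  have := Real.rpow_pos_of_pos hx0 β
  field_simp

theorem aux_limit {k : ℕ} (f : ℝ → (Fin k → ℝ) → ℝ → ℝ)
    (hsm : ContDiff ℝ ∞ (fun p : ℝ × (Fin k → ℝ) × ℝ => f p.1 p.2.1 p.2.2))
    (htriv : ∀ lam : ℝ, f 0 0 lam = 0)
    (hf0 : deriv (fun x => f x 0 0) 0 = 0)
    (f00 : ℝ) (hf00 : f00 = deriv (deriv (fun x => f x 0 0)) 0)
    (fc : Fin k → ℝ)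
    (hfc : ∀ i, fc i = deriv (fun t => f 0 (fun j => if j = i then t else 0) 0) 0)
    (n : ℕ) (u : Fin k → ℝ) (z : ℝ) :
    Tendsto (fun m : ℝ => f (m * z) (m ^ 2 • u) (m ^ (n + 2)) / m ^ 2) (𝓝[>] 0)
      (𝓝 (f00 / 2 * z ^ 2 + ∑ i, fc i * u i)) := by
  set Ff : ℝ × (Fin k → ℝ) × ℝ → ℝ := fun p => f p.1 p.2.1 p.2.2 with hFf
  set h : ℝ → ℝ := fun x => f x 0 0 with hh
  have hhs : ContDiff ℝ ∞ h := by
    have : h = Ff ∘ (fun x : ℝ => (x, (0 : Fin k → ℝ), (0:ℝ))) := rfl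
    rw [this]
    exact hsm.comp (by fun_prop)
  have hhs' : ContDiff ℝ ∞ (deriv h) := (contDiff_infty_iff_deriv.1 hhs).2
  have hmul : ∀ m : ℝ, HasDerivAt (fun m : ℝ => m * z) z m := fun m => by
    simpa using (hasDerivAt_id m).mul_const z
  have hk1 : ∀ m : ℝ, HasDerivAt (fun m => h (m * z)) (deriv h (m * z) * z) m := fun m =>
    HasDerivAt.comp (h₂ := h) m (((hhs.differentiable (by simp)) (m * z)).hasDerivAt) (hmul m)
  have hk2 : HasDerivAt (fun m => deriv h (m * z) * z) (f00 * z * z) 0 := by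
    have h1 := ((hhs'.differentiable (by simp)) (0 * z)).hasDerivAt.comp (0:ℝ) (hmul 0)
    rw [zero_mul, ← hf00] at h1
    exact h1.mul_const z
  have L1 : Tendsto (fun m : ℝ => h (m * z) / m ^ 2) (𝓝[>] 0) (𝓝 (f00 / 2 * z ^ 2)) := by
    refine HasDerivAt.lhopital_zero_nhdsGT (f' := fun m => deriv h (m * z) * z)
          (g' := fun m => 2 * m) ?_ ?_ ?_ ?_ ?_ ?_
    · exact Eventually.of_forall hk1
    · refine Eventually.of_forall fun m => ?_
      simpa using hasDerivAt_pow 2 m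
    · filter_upwards [self_mem_nhdsWithin] with m hm
      have : (0:ℝ) < m := hm
      positivity
    · have := (hk1 0).continuousAt.tendsto
      simp only [zero_mul] at this
      rw [show h 0 = 0 from htriv 0] at this
      exact this.mono_left nhdsWithin_le_nhds
    · have : Tendsto (fun m : ℝ => m ^ 2) (𝓝 0) (𝓝 (0 ^ 2)) := (continuous_pow 2).tendsto 0
      rw [zero_pow two_ne_zero] at this
      exact this.mono_left nhdsWithin_le_nhds
    · have := hasDerivAt_iff_tendsto_slope_zero.1 hk2
      simp only [zero_add, zero_mul, hf0, sub_zero, smul_eq_mul] at this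
      have := (this.mono_left (nhdsGT_le_nhdsNE 0)).div_const 2
      rw [show f00 / 2 * z ^ 2 = f00 * z * z / 2 by ring]
      refine this.congr fun m => ?_
      rw [div_eq_mul_inv, div_eq_mul_inv, mul_inv]
      ring
  have hFd : HasStrictFDerivAt Ff (fderiv ℝ Ff 0) 0 :=
    hsm.contDiffAt.hasStrictFDerivAt (by simp)
  set L := fderiv ℝ Ff 0 with hL
  have hLlam : L (0, 0, 1) = 0 := by
    have h1 : HasDerivAt (fun t : ℝ => ((0:ℝ), (0 : Fin k → ℝ), t)) (0, 0, 1) 0 :=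
      (hasDerivAt_const _ _).prodMk ((hasDerivAt_const _ _).prodMk (hasDerivAt_id _))
    have h2 := (hFd.hasFDerivAt (x := ((0:ℝ), (0 : Fin k → ℝ), (0:ℝ)))).comp_hasDerivAt (0:ℝ) h1
    have h3 : (Ff ∘ fun t : ℝ => ((0:ℝ), (0 : Fin k → ℝ), t)) = fun _ => 0 := by
      funext t
      exact htriv t
    rw [h3] at h2
    exact h2.unique (hasDerivAt_const _ _)
  have hLi : ∀ i, L (0, Pi.single i 1, 0) = fc i := by
    intro i
    have h0 : HasDerivAt (fun t : ℝ => (fun j => if j = i then t else 0 : Fin k → ℝ)) (Pi.single i 1) 0 := by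
      rw [hasDerivAt_pi]
      intro j
      by_cases hj : j = i
      · subst hj
        simpa using hasDerivAt_id' (0:ℝ)
      · simpa [hj] using hasDerivAt_const (0:ℝ) (0:ℝ)
    have h1 : HasDerivAt (fun t : ℝ => ((0:ℝ), (fun j => if j = i then t else 0 : Fin k → ℝ), (0:ℝ)))
        (0, Pi.single i 1, 0) 0 :=
      (hasDerivAt_const _ _).prodMk (h0.prodMk (hasDerivAt_const _ _))
    have e : ((0:ℝ), (fun j => if j = i then (0:ℝ) else 0 : Fin k → ℝ), (0:ℝ)) = 0 := by
      simp; rfl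
    have h2 := HasFDerivAt.comp_hasDerivAt (0:ℝ) (l := Ff) (l' := L) (by rw [e]; exact hFd.hasFDerivAt) h1
    rw [hfc i]
    exact h2.deriv.symm
  have hLu : L (0, u, 0) = ∑ i, fc i * u i := by
    have : ((0:ℝ), u, (0:ℝ)) = ∑ i, u i • ((0:ℝ), (Pi.single i 1 : Fin k → ℝ), (0:ℝ)) := by
      simp only [Prod.smul_mk, ← Pi.single_smul, smul_eq_mul, mul_one]
      ext
      · simp [Prod.fst_sum]
      · simp [Prod.fst_sum, Prod.snd_sum, Finset.sum_apply, Pi.single_apply]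
      · simp [Prod.snd_sum]
    rw [this, map_sum]
    refine Finset.sum_congr rfl fun i _ => ?_
    rw [map_smul, hLi, smul_eq_mul, mul_comm]
  set v : ℝ → ℝ × (Fin k → ℝ) × ℝ := fun m => (0, u, m ^ n) with hv
  have hvc : Continuous v := by fun_prop
  have hLv : ∀ m, L (v m) = ∑ i, fc i * u i := by
    intro m
    have : v m = (0, u, 0) + m ^ n • ((0:ℝ), (0 : Fin k → ℝ), (1:ℝ)) := by
      simp [hv]
    rw [this, map_add, map_smul, hLlam, hLu]
    simp
  have hpath : Tendsto (fun m : ℝ => ((m * z, m ^ 2 • u, m ^ (n + 2)), (m * z, (0 : Fin k → ℝ), (0:ℝ))))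
      (𝓝 0) (𝓝 ((0 : ℝ × (Fin k → ℝ) × ℝ), (0 : ℝ × (Fin k → ℝ) × ℝ))) := by
    have : Continuous (fun m : ℝ => ((m * z, m ^ 2 • u, m ^ (n + 2)), (m * z, (0 : Fin k → ℝ), (0:ℝ)))) := by
      fun_prop
    have := this.tendsto 0
    simpa [← Prod.zero_eq_mk] using this
  have ho := hFd.isLittleO.comp_tendsto hpath
  have ediff : ∀ m : ℝ, ((m * z, m ^ 2 • u, m ^ (n + 2)) : ℝ × (Fin k → ℝ) × ℝ) - (m * z, (0 : Fin k → ℝ), (0:ℝ))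
      = m ^ 2 • v m := by
    intro m
    simp [hv, pow_add, mul_comm]
  have hO : (fun m : ℝ => m ^ 2 • v m) =O[𝓝 0] (fun m : ℝ => m ^ 2) := by
    have := (Asymptotics.isBigO_refl (fun m : ℝ => m ^ 2) (𝓝 0)).smul
      (hvc.continuousAt (x := 0).tendsto.isBigO_one ℝ)
    simpa using this
  have ho2 : (fun m : ℝ => Ff (m * z, m ^ 2 • u, m ^ (n + 2)) - h (m * z) - m ^ 2 * ∑ i, fc i * u i)
      =o[𝓝 0] (fun m : ℝ => m ^ 2) := by
    refine (ho.congr' ?_ ?_).trans_isBigO hO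
    · refine Eventually.of_forall fun m => ?_
      simp only [Function.comp]
      rw [ediff, map_smul, hLv, smul_eq_mul]
    · refine Eventually.of_forall fun m => ?_
      simp only [Function.comp]
      rw [ediff]
  have L2 := (ho2.tendsto_div_nhds_zero).mono_left (nhdsWithin_le_nhds (s := Ioi 0))
  have L3 := (L1.add L2).add_const (∑ i, fc i * u i)
  rw [add_zero] at L3
  refine L3.congr' ?_
  filter_upwards [self_mem_nhdsWithin] with m hm
  have : (0:ℝ) < m := hm
  simp only [hFf]
  field_simp
  ring

theorem aux_rolle (d : ℝ) (g g1 g2 : ℝ → ℝ) (h1 : ∀ x, HasDerivAt g (g1 x) x)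
    (h2 : ∀ x, HasDerivAt g1 (g2 x) x) (hne : ∀ x, |x| < d → g2 x ≠ 0)
    (a b c : ℝ) (hab : a < b) (hbc : b < c) (ha : |a| < d) (hc : |c| < d)
    (ga : g a = 0) (gb : g b = 0) (gc : g c = 0) : False := by
  have cg : Continuous g := continuous_iff_continuousAt.2 fun x => (h1 x).continuousAt
  have cg1 : Continuous g1 := continuous_iff_continuousAt.2 fun x => (h2 x).continuousAt
  obtain ⟨p, hp, hp0⟩ := exists_hasDerivAt_eq_zero hab cg.continuousOn (ga.trans gb.symm) fun x _ => h1 x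
  obtain ⟨q, hq, hq0⟩ := exists_hasDerivAt_eq_zero hbc cg.continuousOn (gb.trans gc.symm) fun x _ => h1 x
  obtain ⟨r, hr, hr0⟩ := exists_hasDerivAt_eq_zero (hp.2.trans hq.1) cg1.continuousOn
    (hp0.trans hq0.symm) fun x _ => h2 x
  refine hne r ?_ hr0
  rw [abs_lt] at *
  exact ⟨by linarith [hp.1, hr.1], by linarith [hq.2, hr.2]⟩

theorem aux_three (d : ℝ) (g g1 g2 : ℝ → ℝ) (h1 : ∀ x, HasDerivAt g (g1 x) x)
    (h2 : ∀ x, HasDerivAt g1 (g2 x) x) (hne : ∀ x, |x| < d → g2 x ≠ 0)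
    (a b x : ℝ) (hab : a < b) (ha : |a| < d) (hb : |b| < d) (hx : |x| < d)
    (ga : g a = 0) (gb : g b = 0) (gx : g x = 0) : x = b ∨ x = a := by
  have R := aux_rolle d g g1 g2 h1 h2 hne
  rcases lt_trichotomy x a with h | h | h
  · exact (R x a b h hab hx hb gx ga gb).elim
  · exact Or.inr h
  · rcases lt_trichotomy x b with h' | h' | h'
    · exact (R a x b h h' ha hb ga gx gb).elim
    · exact Or.inl h'
    · exact (R a b x hab h' ha hx ga gb gx).elim

theorem aux_G {k : ℕ} (f : ℝ → (Fin k → ℝ) → ℝ → ℝ)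
    (hsm : ContDiff ℝ ∞ (fun p : ℝ × (Fin k → ℝ) × ℝ => f p.1 p.2.1 p.2.2))
    (n : ℕ) (V : (Fin k → ℝ) → ℝ → ℝ)
    (hV : ∀ u z, Tendsto (fun m : ℝ => f (m * z) (m ^ 2 • u) (m ^ (n + 2)) / m ^ 2) (𝓝[>] 0)
      (𝓝 (V u z))) :
    ∃ G : ((Fin k → ℝ) × ℝ) × ℝ → ℝ, ContDiff ℝ ∞ G ∧ (∀ u z, G ((u, 0), z) = V u z) ∧
      ∀ m u z, f (m * z) (m ^ 2 • u) (m ^ (n + 2)) = m ^ 2 * G ((u, m), z) := by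
  set Φ : ℝ × ((Fin k → ℝ) × ℝ) → ℝ := fun q => f (q.1 * q.2.2) (q.1 ^ 2 • q.2.1) (q.1 ^ (n + 2)) with hΦ
  have hΦs : ContDiff ℝ ∞ Φ := by
    have e : Φ = (fun p : ℝ × (Fin k → ℝ) × ℝ => f p.1 p.2.1 p.2.2) ∘
      (fun q : ℝ × ((Fin k → ℝ) × ℝ) => (q.1 * q.2.2, q.1 ^ 2 • q.2.1, q.1 ^ (n + 2))) := rfl
    rw [e]
    exact hsm.comp (by fun_prop)
  have tm : Tendsto (fun m : ℝ => m) (𝓝[>] 0) (𝓝 0) := tendsto_id.mono_left nhdsWithin_le_nhds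
  have hV1 : ∀ w : (Fin k → ℝ) × ℝ, Tendsto (fun m : ℝ => Φ (m, w) / m) (𝓝[>] 0) (𝓝 0) := by
    intro w
    have := (hV w.1 w.2).mul tm
    rw [mul_zero] at this
    refine this.congr' ?_
    filter_upwards [self_mem_nhdsWithin] with m hm
    have : (0:ℝ) < m := hm
    simp only [hΦ]
    field_simp
  have lim : ∀ (Θ : ℝ × ((Fin k → ℝ) × ℝ) → ℝ), Continuous Θ → ∀ w,
      Tendsto (fun m : ℝ => Θ (m, w)) (𝓝[>] 0) (𝓝 (Θ (0, w))) := by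
    intro Θ hΘ w
    have : Continuous fun m : ℝ => Θ (m, w) := by fun_prop
    exact (this.tendsto 0).mono_left nhdsWithin_le_nhds
  have hΦ0 : ∀ w, Φ (0, w) = 0 := by
    intro w
    have h2 := (hV1 w).mul tm
    rw [mul_zero] at h2
    refine tendsto_nhds_unique (lim Φ hΦs.continuous w) (h2.congr' ?_)
    filter_upwards [self_mem_nhdsWithin] with m hm
    exact div_mul_cancel₀ _ (ne_of_gt (mem_Ioi.1 hm))
  obtain ⟨Ψ, hΨs, hΨ⟩ := aux_hadamard Φ hΦs hΦ0
  have hΨ0 : ∀ w, Ψ (0, w) = 0 := by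
    intro w
    refine tendsto_nhds_unique (lim Ψ hΨs.continuous w) ((hV1 w).congr' ?_)
    filter_upwards [self_mem_nhdsWithin] with m hm
    rw [hΨ, mul_div_cancel_left₀ _ (ne_of_gt (mem_Ioi.1 hm))]
  obtain ⟨Ω, hΩs, hΩ⟩ := aux_hadamard Ψ hΨs hΨ0
  have key : ∀ m w, Φ (m, w) = m ^ 2 * Ω (m, w) := by
    intro m w
    rw [hΨ, hΩ]; ring
  refine ⟨fun q => Ω (q.1.2, (q.1.1, q.2)), hΩs.comp (by fun_prop), ?_, ?_⟩
  · intro u z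
    refine tendsto_nhds_unique (lim Ω hΩs.continuous (u, z)) ((hV u z).congr' ?_)
    filter_upwards [self_mem_nhdsWithin] with m hm
    have h1 := key m (u, z)
    have : (0:ℝ) < m := hm
    simp only [hΦ] at h1
    rw [h1, mul_div_cancel_left₀ _ (by positivity)]
  · intro m u z
    exact key m (u, z)

theorem aux_branch {k : ℕ} (G : ((Fin k → ℝ) × ℝ) × ℝ → ℝ) (hG : ContDiff ℝ ∞ G)
    (a : ℝ) (ha : a ≠ 0) (l : (Fin k → ℝ) → ℝ)
    (hV : ∀ u z, G ((u, 0), z) = a / 2 * z ^ 2 + l u)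
    (M : ℝ) (hM : 0 < M) (u : ℝ → Fin k → ℝ) (hu : ContDiffOn ℝ ∞ u (Ico 0 M))
    (z0 : ℝ) (hz0 : z0 ≠ 0) (hz : a / 2 * z0 ^ 2 + l (u 0) = 0) :
    ∃ ε : ℝ, 0 < ε ∧ ε ≤ M ∧ ∃ z : ℝ → ℝ, ContDiffOn ℝ ∞ z (Ico 0 ε) ∧
      Tendsto z (𝓝[>] 0) (𝓝 z0) ∧ ∀ m ∈ Ico 0 ε, G ((u m, m), z m) = 0 := by
  have hd : fderiv ℝ G ((u 0, 0), z0) (0, 1) ≠ 0 := by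
    have h1 : HasDerivAt (fun z : ℝ => ((u 0, (0:ℝ)), z)) (0, 1) z0 :=
      (hasDerivAt_const _ _).prodMk (hasDerivAt_id _)
    have h2 := ((hG.differentiable (by simp)) ((u 0, 0), z0)).hasFDerivAt.comp_hasDerivAt z0 h1
    have h3 : (G ∘ fun z : ℝ => ((u 0, (0:ℝ)), z)) = fun z => a / 2 * z ^ 2 + l (u 0) := by
      funext z
      exact hV _ _
    rw [h3] at h2
    have h4 : HasDerivAt (fun z => a / 2 * z ^ 2 + l (u 0)) (a / 2 * (2 * z0)) z0 := by
      simpa using ((hasDerivAt_pow 2 z0).const_mul (a / 2)).add_const (l (u 0))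
    rw [h2.unique h4]
    have : a / 2 * (2 * z0) = a * z0 := by ring
    rw [this]
    exact mul_ne_zero ha hz0
  obtain ⟨ψ, h1, h2⟩ := aux_implicit G hG (u 0, 0) z0 (by rw [hV]; exact hz) hd
  have h0mem : (0:ℝ) ∈ Ico 0 M := ⟨le_rfl, hM⟩
  have hc : ContinuousWithinAt (fun m => (u m, m)) (Ico 0 M) 0 :=
    (hu.continuousOn 0 h0mem).prodMk continuousWithinAt_id
  have h3 := hc.eventually h2
  rw [eventually_nhdsWithin_iff, Metric.eventually_nhds_iff] at h3
  obtain ⟨η, hη, h3⟩ := h3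
  have h4 : ∀ m ∈ Ico 0 (min η M), m ∈ Ico 0 M ∧ G ((u m, m), ψ (u m, m)) = 0 ∧ ContDiffAt ℝ ∞ ψ (u m, m) := by
    intro m hm
    have hmM : m ∈ Ico 0 M := ⟨hm.1, hm.2.trans_le (min_le_right _ _)⟩
    refine ⟨hmM, h3 ?_ hmM⟩
    rw [Real.dist_eq, sub_zero, abs_of_nonneg hm.1]
    exact hm.2.trans_le (min_le_left _ _)
  have hεpos : 0 < min η M := lt_min hη hM
  have hs : ContDiffOn ℝ ∞ (fun m => ψ (u m, m)) (Ico 0 (min η M)) := by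
    intro m hm
    obtain ⟨a1, a2, a3⟩ := h4 m hm
    refine a3.comp_contDiffWithinAt (f := fun m => (u m, m)) m ?_
    exact ((hu m a1).mono (fun x hx => (h4 x hx).1)).prodMk contDiffWithinAt_id
  refine ⟨min η M, hεpos, min_le_right _ _, fun m => ψ (u m, m), hs, ?_, fun m hm => (h4 m hm).2.1⟩
  have hle : 𝓝[>] (0:ℝ) ≤ 𝓝[Ico 0 (min η M)] 0 :=
    le_inf nhdsWithin_le_nhds (le_principal_iff.2 (Ico_mem_nhdsGT hεpos))
  have := (hs.continuousOn 0 ⟨le_rfl, hεpos⟩).mono_left hle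
  simp only [h1] at this
  exact this

end AuxSection

/-- growth lemma, part (i): if `Z = (Σ_{i∈A} f_i s_i)/f₀₀ < 0`,
then the solutions of `f(x, y(λ), λ) = 0` for small `λ > 0` are exactly two
germs `b⁺, b⁻` of square-root-order `p + 1` with slopes `±√(−2Z)`. -/
theorem stmt_18 {k : ℕ} (f : ℝ → (Fin k → ℝ) → ℝ → ℝ)
    (hsm : ContDiff ℝ (⊤ : ℕ∞) (fun p : ℝ × (Fin k → ℝ) × ℝ => f p.1 p.2.1 p.2.2))
    (htriv : ∀ lam : ℝ, f 0 0 lam = 0)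
    (hf0 : deriv (fun x => f x 0 0) 0 = 0)
    (f00 : ℝ) (hf00 : f00 = deriv (deriv (fun x => f x 0 0)) 0) (hf00ne : f00 ≠ 0)
    (fc : Fin k → ℝ)
    (hfc : ∀ i, fc i = deriv (fun t => f 0 (fun j => if j = i then t else 0) 0) 0)
    (lam0 : ℝ) (hlam0 : 0 < lam0)
    (y : ℝ → Fin k → ℝ) (hy : ContinuousOn y (Set.Ico 0 lam0)) (hy0 : y 0 = 0)
    (p : Fin k → ℤ) (s : Fin k → ℝ)
    (hsro : ∀ i, hasSqrtOrder lam0 (fun lam => y lam i) (p i) (s i))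
    (pmax : ℤ) (hpmax : 0 ≤ pmax) (hub : ∀ i, p i ≤ pmax) (hex : ∃ i, p i = pmax)
    (Z : ℝ)
    (hZdef : Z = (∑ i ∈ Finset.univ.filter (fun i => p i = pmax), fc i * s i) / f00)
    (hZ : Z < 0) :
    ∃ lamstar : ℝ, 0 < lamstar ∧ lamstar ≤ lam0 ∧
      ∃ bp bm : ℝ → ℝ,
        hasSqrtOrder lamstar bp (pmax + 1) (Real.sqrt (-2 * Z)) ∧
        hasSqrtOrder lamstar bm (pmax + 1) (-Real.sqrt (-2 * Z)) ∧
        ∃ δ > (0 : ℝ), ∀ lam : ℝ, 0 < lam → lam < lamstar →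
          ∀ x : ℝ, |x| < δ →
            (f x (y lam) lam = 0 ↔ x = bp lam ∨ x = bm lam) := by
  obtain ⟨P, rfl⟩ := Int.eq_ofNat_of_zero_le hpmax
  obtain ⟨n, hn⟩ : ∃ n, 2 ^ (P + 1) = n + 2 :=
    Nat.exists_eq_add_of_le' (by
      calc 2 = 2 ^ 1 := rfl
        _ ≤ 2 ^ (P + 1) := Nat.pow_le_pow_right (by norm_num) (by omega))
  -- the rescaled equation
  obtain ⟨G, hG, hG0, hGf⟩ := aux_G f hsm n _
    (aux_limit f hsm htriv hf0 f00 hf00 fc hfc n)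
  -- the rescaled inputs
  choose u hu1 hu2 hu3 using fun i => aux_u lam0 hlam0 _ _ _ (hsro i) P (hub i)
  set M : ℝ := lam0 ^ ((2:ℝ) ^ (-((P + 1 : ℕ):ℤ))) with hM
  have hMpos : 0 < M := Real.rpow_pos_of_pos hlam0 _
  set U : ℝ → Fin k → ℝ := fun m i => u i m with hU
  have hUs : ContDiffOn ℝ (⊤ : ℕ∞) U (Set.Ico 0 M) := contDiffOn_pi.2 hu1
  have hyU : ∀ m ∈ Set.Ico 0 M, y (m ^ (n + 2)) = m ^ 2 • U m := by
    intro m hm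
    funext i
    have := hu3 i m hm
    rw [hn] at this
    simpa using this
  have hl0 : ∑ i, fc i * U 0 i = f00 * Z := by
    rw [hZdef, mul_div_cancel₀ _ hf00ne, Finset.sum_filter]
    refine Finset.sum_congr rfl fun i _ => ?_
    simp only [hU, hu2]
    split_ifs <;> simp
  set σ := Real.sqrt (-2 * Z) with hσ
  have hσpos : 0 < σ := Real.sqrt_pos.2 (by linarith)
  have hσ2 : σ ^ 2 = -2 * Z := Real.sq_sqrt (by linarith)
  obtain ⟨ε1, he1, he1M, z1, hz1s, hz1t, hz1⟩ := aux_branch G hG f00 hf00ne (fun u => ∑ i, fc i * u i)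
    hG0 M hMpos U hUs σ hσpos.ne' (by simp only [hl0, hσ2]; ring)
  obtain ⟨ε2, he2, he2M, z2, hz2s, hz2t, hz2⟩ := aux_branch G hG f00 hf00ne (fun u => ∑ i, fc i * u i)
    hG0 M hMpos U hUs (-σ) (by simpa using hσpos.ne') (by simp only [hl0, neg_sq, hσ2]; ring)
  -- second derivative in x
  set Ff : ℝ × (Fin k → ℝ) × ℝ → ℝ := fun p => f p.1 p.2.1 p.2.2 with hFf
  set D1 : ℝ × (Fin k → ℝ) × ℝ → ℝ := fun q => fderiv ℝ Ff q (1, 0) with hD1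
  have hD1s : ContDiff ℝ (⊤ : ℕ∞) D1 :=
    (hsm.fderiv_right (m := (⊤ : ℕ∞)) (by simp)).clm_apply contDiff_const
  set D2 : ℝ × (Fin k → ℝ) × ℝ → ℝ := fun q => fderiv ℝ D1 q (1, 0) with hD2
  have hD2c : Continuous D2 :=
    ((hD1s.fderiv_right (m := (⊤ : ℕ∞)) (by simp)).clm_apply contDiff_const).continuous
  have hpath : ∀ (w : (Fin k → ℝ) × ℝ) (x : ℝ),
      HasDerivAt (fun x : ℝ => (x, w)) ((1:ℝ), (0 : (Fin k → ℝ) × ℝ)) x := fun w x =>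
    (hasDerivAt_id x).prodMk (hasDerivAt_const _ _)
  have hd1 : ∀ w x, HasDerivAt (fun x => Ff (x, w)) (D1 (x, w)) x := fun w x =>
    HasFDerivAt.comp_hasDerivAt (l := Ff) x ((hsm.differentiable (by simp)) (x, w)).hasFDerivAt (hpath w x)
  have hd2 : ∀ w x, HasDerivAt (fun x => D1 (x, w)) (D2 (x, w)) x := fun w x =>
    HasFDerivAt.comp_hasDerivAt (l := D1) x ((hD1s.differentiable (by simp)) (x, w)).hasFDerivAt (hpath w x)
  have hD20 : D2 0 ≠ 0 := by
    have e1 : deriv (fun x => f x 0 0) = fun x => D1 (x, 0) := by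
      funext x
      exact (hd1 0 x).deriv
    rw [e1] at hf00
    have e2 := (hd2 0 0).deriv
    rw [← hf00] at e2
    have e3 : D2 0 = f00 := e2.symm
    rw [e3]; exact hf00ne
  obtain ⟨δ, hδ, hD2δ⟩ := Metric.eventually_nhds_iff.1 (hD2c.continuousAt.eventually_ne hD20)
  have hne : ∀ x (w : (Fin k → ℝ) × ℝ), |x| < δ → ‖w‖ < δ → D2 (x, w) ≠ 0 := by
    intro x w hx hw
    refine hD2δ ?_
    rw [dist_zero_right, Prod.norm_def, max_lt_iff]
    exact ⟨hx, hw⟩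
  -- smallness
  have hmt : Filter.Tendsto (fun m : ℝ => m) (nhdsWithin 0 (Set.Ioi 0)) (nhds 0) :=
    Filter.tendsto_id.mono_left nhdsWithin_le_nhds
  have hb1 : Filter.Tendsto (fun m : ℝ => m * z1 m) (nhdsWithin 0 (Set.Ioi 0)) (nhds 0) := by
    simpa using hmt.mul hz1t
  have hb2 : Filter.Tendsto (fun m : ℝ => m * z2 m) (nhdsWithin 0 (Set.Ioi 0)) (nhds 0) := by
    simpa using hmt.mul hz2t
  have hUt : Filter.Tendsto U (nhdsWithin 0 (Set.Ioi 0)) (nhds (U 0)) :=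
    (hUs.continuousOn 0 ⟨le_rfl, hMpos⟩).mono_left
      (le_inf nhdsWithin_le_nhds (Filter.le_principal_iff.2 (Ico_mem_nhdsGT hMpos)))
  have hwt : Filter.Tendsto (fun m : ℝ => (m ^ 2 • U m, m ^ (n + 2))) (nhdsWithin 0 (Set.Ioi 0)) (nhds 0) := by
    have := ((hmt.pow 2).smul hUt).prodMk_nhds (hmt.pow (n + 2))
    simpa [← Prod.zero_eq_mk] using this
  have hab : ∀ (g : ℝ → ℝ), Filter.Tendsto g (nhdsWithin 0 (Set.Ioi 0)) (nhds 0) →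
      ∀ᶠ m in nhdsWithin 0 (Set.Ioi 0), |g m| < δ := by
    intro g hg
    have := hg.abs
    rw [abs_zero] at this
    exact this.eventually_lt_const hδ
  have hnw : ∀ᶠ m in nhdsWithin (0:ℝ) (Set.Ioi 0), ‖(m ^ 2 • U m, m ^ (n + 2))‖ < δ := by
    have := hwt.norm
    rw [norm_zero] at this
    exact this.eventually_lt_const hδ
  have hall := (hab _ hb1).and ((hab _ hb2).and (hnw.and
    ((hz1t.eventually_const_lt hσpos).and (hz2t.eventually_lt_const (neg_lt_zero.2 hσpos)))))
  obtain ⟨ε3, he3, hall⟩ := mem_nhdsGT_iff_exists_Ioo_subset.1 hall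
  have he3 : 0 < ε3 := he3
  set ε := min ε1 (min ε2 ε3) with hε
  have hεpos : 0 < ε := lt_min he1 (lt_min he2 he3)
  have hεε1 : ε ≤ ε1 := min_le_left _ _
  have hεε2 : ε ≤ ε2 := (min_le_right _ _).trans (min_le_left _ _)
  have hεε3 : ε ≤ ε3 := (min_le_right _ _).trans (min_le_right _ _)
  have hroot : (ε ^ (2 ^ (P + 1))) ^ ((2:ℝ) ^ (-((P + 1 : ℕ):ℤ))) = ε := by
    rw [aux_pow P (P + 1) le_rfl ε hεpos.le]; simp
  have hsl : ∀ (z : ℝ → ℝ) (c : ℝ), Filter.Tendsto z (nhdsWithin 0 (Set.Ioi 0)) (nhds c) →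
      slopeTendsto (fun m => m * z m) c := by
    intro z c hz
    refine hz.congr' ?_
    filter_upwards [self_mem_nhdsWithin] with m hm
    rw [mul_div_cancel_left₀ _ (ne_of_gt (Set.mem_Ioi.1 hm))]
  refine ⟨ε ^ (2 ^ (P + 1)), by positivity, ?_,
    fun x => (fun m => m * z1 m) (x ^ ((2:ℝ) ^ (-((P + 1 : ℕ):ℤ)))),
    fun x => (fun m => m * z2 m) (x ^ ((2:ℝ) ^ (-((P + 1 : ℕ):ℤ)))), ?_, ?_, δ, hδ, ?_⟩
  · calc ε ^ (2 ^ (P + 1)) ≤ M ^ (2 ^ (P + 1)) :=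
          pow_le_pow_left₀ hεpos.le (hεε1.trans he1M) _
      _ = lam0 := aux_pow' P lam0 hlam0.le
  · refine aux_order _ (by positivity) (P + 1) (fun m => m * z1 m) σ hσpos.ne' ?_ (hsl _ _ hz1t)
    rw [hroot]
    exact contDiffOn_id.mul (hz1s.mono (Set.Ico_subset_Ico_right hεε1))
  · refine aux_order _ (by positivity) (P + 1) (fun m => m * z2 m) (-σ) (by simpa using hσpos.ne') ?_ (hsl _ _ hz2t)
    rw [hroot]
    exact contDiffOn_id.mul (hz2s.mono (Set.Ico_subset_Ico_right hεε2))
  · intro lam hlam hlam' x hx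
    have hm : lam = (lam ^ ((2:ℝ) ^ (-((P + 1 : ℕ):ℤ)))) ^ (2 ^ (P + 1)) := (aux_pow' P lam hlam.le).symm
    have hmpos : 0 < lam ^ ((2:ℝ) ^ (-((P + 1 : ℕ):ℤ))) := Real.rpow_pos_of_pos hlam _
    have hmlt : lam ^ ((2:ℝ) ^ (-((P + 1 : ℕ):ℤ))) < ε := by
      rw [← hroot]
      exact Real.rpow_lt_rpow hlam.le hlam' (by positivity)
    beta_reduce
    generalize lam ^ ((2:ℝ) ^ (-((P + 1 : ℕ):ℤ))) = m at hm hmpos hmlt ⊢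
    rw [hn] at hm
    subst hm
    have hmM : m ∈ Set.Ico 0 M := ⟨hmpos.le, hmlt.trans_le (hεε1.trans he1M)⟩
    obtain ⟨a1, a2, a3, a4, a5⟩ := hall ⟨hmpos, hmlt.trans_le hεε3⟩
    rw [hyU m hmM]
    have r1 : f (m * z1 m) (m ^ 2 • U m) (m ^ (n + 2)) = 0 := by
      rw [hGf, hz1 m ⟨hmpos.le, hmlt.trans_le hεε1⟩, mul_zero]
    have r2 : f (m * z2 m) (m ^ 2 • U m) (m ^ (n + 2)) = 0 := by
      rw [hGf, hz2 m ⟨hmpos.le, hmlt.trans_le hεε2⟩, mul_zero]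
    constructor
    · intro hfx
      have hlt : m * z2 m < m * z1 m := mul_lt_mul_of_pos_left (a5.trans a4) hmpos
      exact aux_three δ (fun x => Ff (x, (m ^ 2 • U m, m ^ (n + 2)))) _ _ (hd1 _) (hd2 _)
        (fun x hx => hne x _ hx a3) _ _ x hlt a2 a1 hx r2 r1 hfx
    · rintro (h | h)
      · rw [h]; exact r1
      · rw [h]; exact r2
end
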